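/- Let X be a compact metric space and let κ be a Markov kernel from X to X. For a bounded measurable φ : X → ℝ define (Pφ)(x) = ∫ φ(y) dκ(x)(y), and let Pⁿφ denote the n-th iterate. Assume that for every Lipschitz function φ : X → ℝ and every ε > 0 there exists n ∈ ℕ with sup over x, y ∈ X of |Pⁿφ(x) − Pⁿφ(y)| ≤ ε. Then κ has at most one invariant Borel probability measure: if η and η′ are Borel probability measures on X with η.bind κ = η and η′.bind κ = η′, then η = η′. -/

import Mathlib

noncomputable section

open MeasureTheory ProbabilityTheory
open scoped NNReal

/-- The Markov operator of a kernel `κ`: `(Pφ)(x) = ∫ φ(y) dκ(x)(y)`. -/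
def markovOp {X : Type*} [MeasurableSpace X] (κ : Kernel X X) (φ : X → ℝ) : X → ℝ :=
  fun x => ∫ y, φ y ∂(κ x)

/-- Iterates of the Markov operator stay measurable and bounded, with the same integral. -/
theorem iter_aux {X : Type*} [MeasurableSpace X] (κ : Kernel X X) [IsMarkovKernel κ]
    (φ : X → ℝ) (hφ : StronglyMeasurable φ) (C : ℝ) (hC : ∀ x, ‖φ x‖ ≤ C) (n : ℕ) :
    StronglyMeasurable ((markovOp κ)^[n] φ) ∧ (∀ x, ‖(markovOp κ)^[n] φ x‖ ≤ C) ∧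
    ∀ (η : Measure X) [IsProbabilityMeasure η], η.bind (fun x => κ x) = η →
      ∫ x, (markovOp κ)^[n] φ x ∂η = ∫ x, φ x ∂η := by
  induction n with
  | zero => exact ⟨hφ, hC, fun _ _ _ => rfl⟩
  | succ k ih =>
    obtain ⟨h1, h2, h3⟩ := ih
    simp only [Function.iterate_succ', Function.comp_apply]
    refine ⟨h1.integral_kernel, fun x => ?_, fun η _ hη => ?_⟩
    · have := norm_integral_le_of_norm_le_const (μ := κ x) (Filter.Eventually.of_forall h2)
      simpa [markovOp] using this
    · rw [← h3 η hη]
      have e : (κ ∘ₖ Kernel.const Unit η) () = η := by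
        rw [Kernel.comp_apply, Kernel.const_apply]; exact hη
      have hi : Integrable ((markovOp κ)^[k] φ) ((κ ∘ₖ Kernel.const Unit η) ()) := by
        rw [e]
        exact Integrable.of_bound h1.aestronglyMeasurable C (Filter.Eventually.of_forall h2)
      have := Kernel.integral_comp hi
      rw [e, Kernel.const_apply] at this
      exact this.symm

theorem integral_close {X : Type*} [MeasurableSpace X] (ψ : X → ℝ) (η η' : Measure X)
    [IsProbabilityMeasure η] [IsProbabilityMeasure η'] (hi : Integrable ψ η)
    (hi' : Integrable ψ η') (ε : ℝ) (h : ∀ x y, |ψ x - ψ y| ≤ ε) :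
    ∫ x, ψ x ∂η ≤ ∫ x, ψ x ∂η' + ε := by
  have h1 : ∀ y, ∫ x, ψ x ∂η ≤ ψ y + ε := fun y => by
    have := integral_mono hi (integrable_const (ψ y + ε))
      (fun x => by have := (abs_le.1 (h x y)).2; simp only; linarith)
    simpa using this
  have := integral_mono (integrable_const (∫ x, ψ x ∂η)) (hi'.add (integrable_const ε)) h1
  simp only [Pi.add_apply] at this
  rw [integral_add hi' (integrable_const ε)] at this
  simpa using this

/-- if the iterates of the Markov operator of a Markov kernel `κ` on a
compact metric space flatten every Lipschitz function (oscillation eventually below any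
`ε > 0`), then `κ` has at most one invariant Borel probability measure. -/
theorem stmt12 {X : Type*} [MetricSpace X] [CompactSpace X]
    [MeasurableSpace X] [BorelSpace X]
    (κ : Kernel X X) [IsMarkovKernel κ]
    (hmix : ∀ φ : X → ℝ, (∃ K : ℝ≥0, LipschitzWith K φ) → ∀ ε > (0 : ℝ), ∃ n : ℕ,
      ∀ x y : X, |(markovOp κ)^[n] φ x - (markovOp κ)^[n] φ y| ≤ ε)
    (η η' : Measure X) [IsProbabilityMeasure η] [IsProbabilityMeasure η']
    (hη : η.bind (fun x => κ x) = η) (hη' : η'.bind (fun x => κ x) = η') :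
    η = η' := by
  have key : ∀ φ : X → ℝ, (∃ K : ℝ≥0, LipschitzWith K φ) → ∫ x, φ x ∂η = ∫ x, φ x ∂η' := by
    rintro φ ⟨K, hK⟩
    obtain ⟨C, hC⟩ := isCompact_univ.exists_bound_of_continuousOn hK.continuous.continuousOn
    have aux := iter_aux κ φ hK.continuous.stronglyMeasurable C (fun x => hC x trivial)
    apply le_antisymm
    all_goals
      refine le_of_forall_pos_le_add fun ε hε => ?_
      obtain ⟨n, hn⟩ := hmix φ ⟨K, hK⟩ ε hε
      obtain ⟨h1, h2, h3⟩ := aux n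
      rw [← h3 η hη, ← h3 η' hη']
      exact integral_close _ _ _
        (Integrable.of_bound h1.aestronglyMeasurable C (Filter.Eventually.of_forall h2))
        (Integrable.of_bound h1.aestronglyMeasurable C (Filter.Eventually.of_forall h2)) ε hn
  apply ext_of_generate_finite _ ?_ isPiSystem_isClosed
  · intro F hF
    have hlim := tendsto_one_div_add_atTop_nhds_zero_nat (𝕜 := ℝ)
    have t := tendsto_integral_thickenedIndicator_of_isClosed η hF
      (fun _ => Nat.one_div_pos_of_nat) hlim
    have t' := tendsto_integral_thickenedIndicator_of_isClosed η' hF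
      (fun _ => Nat.one_div_pos_of_nat) hlim
    have e := tendsto_nhds_unique (t.congr fun n => key _
      ⟨_, NNReal.isometry_coe.lipschitz.comp (lipschitzWith_thickenedIndicator _ F)⟩) t'
    exact (measureReal_eq_measureReal_iff).1 e
  · simp
  · rw [BorelSpace.measurable_eq (α := X), borel_eq_generateFrom_isClosed]

end
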